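/- Let F be a totally real number field, K/F a CM extension with ker(i_{K/F}) ≠ {1}, and [a] the unique nontrivial class of ker(i_{K/F}). For any O_F-order B ⊆ O_K with [a] ∈ ker(i_{B/O_F}), the index [O_K^× : B^×] is odd. Moreover, if K ≠ F(√−1) then 2O_K ⊆ B, while if K = F(√−1) then (2 − η − η̄)O_K ⊆ B, where η = ζ_{2ⁿ} with n the largest integer such that ζ_{2ⁿ} ∈ K. -/

import Mathlib

/-!
STATEMENT 18: Let `F` be a totally real number field, `K/F` a CM extension with
`ker (i_{K/F}) ≠ {1}`, and `[a]` the unique nontrivial class of `ker (i_{K/F})`.  For any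
`O_F`-order `B ⊆ O_K` with `[a] ∈ ker (i_{B/O_F})`, the index `[O_K^× : B^×]` is odd.
Moreover, if `K ≠ F(√−1)` then `2·O_K ⊆ B`, while if `K = F(√−1)` then
`(2 − η − η̄)·O_K ⊆ B`, where `η = ζ_{2ⁿ}` with `n` the largest integer such that
`ζ_{2ⁿ} ∈ K`.

Conventions as in Statement 17; `η̄ = σ η` for the nontrivial `F`-automorphism `σ` of `K`;
the unit index is the index of the image of `B^×` in `O_K^×`.
-/

noncomputable section
set_option synthInstance.maxHeartbeats 1000000
set_option maxHeartbeats 1000000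

/-- `F` is totally real: every complex embedding of `F` is real. -/
def TotReal (F : Type*) [Field F] [NumberField F] : Prop :=
  ∀ φ : F →+* ℂ, NumberField.ComplexEmbedding.IsReal φ

/-- A `ℤ`-order in a `ℚ`-algebra `V`: a subring, finitely generated as a `ℤ`-module,
containing a `ℚ`-basis of `V` (i.e. spanning `V` over `ℚ`). -/
def IsZOrder {V : Type*} [Ring V] [Algebra ℚ V] (O : Subalgebra ℤ V) : Prop :=
  (Subalgebra.toSubmodule O).FG ∧ Submodule.span ℚ (O : Set V) = ⊤

section RootsOfUnity

variable {K : Type*} [Field K]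

/-- If `η` generates the roots of unity of `2`-power order, every root of unity has an odd power
that is a power of `η`. -/
lemma exists_odd_pow_eq_pow {n : ℕ} {η : K} (hη : IsPrimitiveRoot η (2 ^ n))
    (hmax : ¬ ∃ ξ : K, IsPrimitiveRoot ξ (2 ^ (n + 1))) {ζ : K} (hζ : IsOfFinOrder ζ) :
    ∃ m l, Odd m ∧ ζ ^ m = η ^ l := by
  have hpos : 0 < orderOf ζ := hζ.orderOf_pos
  obtain ⟨k, m, hm, hkm⟩ := Nat.exists_eq_two_pow_mul_odd hpos.ne'
  have hprim : IsPrimitiveRoot (ζ ^ m) (2 ^ k) :=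
    (IsPrimitiveRoot.orderOf ζ).pow hpos (by rw [hkm, mul_comm])
  have hkn : k ≤ n := by
    by_contra! h
    refine hmax ⟨(ζ ^ m) ^ 2 ^ (k - (n + 1)), hprim.pow (by positivity) ?_⟩
    rw [← pow_add]
    congr 1
    omega
  have hone : (ζ ^ m) ^ 2 ^ n = 1 := by
    obtain ⟨d, rfl⟩ := Nat.exists_eq_add_of_le hkn
    rw [pow_add, pow_mul, hprim.pow_eq_one, one_pow]
  obtain ⟨l, -, hl⟩ := hη.eq_pow_of_pow_eq_one hone
  exact ⟨m, l, hm, hl.symm⟩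

/-- If `η` generates the roots of unity of `2`-power order, it is an odd power of every root of
unity that is not a square. -/
lemma exists_odd_pow_eq_of_not_isSquare [CharZero K] {n : ℕ} {η : K}
    (hη : IsPrimitiveRoot η (2 ^ n)) (hmax : ¬ ∃ ξ : K, IsPrimitiveRoot ξ (2 ^ (n + 1)))
    {u : K} (hu : IsOfFinOrder u) (hsq : ¬ IsSquare u) :
    ∃ i, u ^ (2 * i + 1) = η := by
  have hu0 : u ≠ 0 := fun h ↦ hsq (h ▸ IsSquare.zero)
  have hn : n ≠ 0 := by
    rintro rfl
    exact hmax ⟨-1, by simpa using IsPrimitiveRoot.neg_one (R := K) 0 (by norm_num)⟩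
  obtain ⟨m, l, ⟨k, rfl⟩, hm⟩ := exists_odd_pow_eq_pow hη hmax hu
  have hl : Odd l := by
    by_contra h
    obtain ⟨r, rfl⟩ := Nat.not_odd_iff_even.mp h
    refine hsq ⟨η ^ r / u ^ k, ?_⟩
    field_simp
    calc u * (u ^ k) ^ 2 = u ^ (2 * k + 1) := by ring
      _ = η ^ (r + r) := hm
      _ = (η ^ r) ^ 2 := by ring
  obtain ⟨l', -, hl'⟩ := Nat.exists_mul_mod_eq_one_of_coprime
    (hl.coprime_two_right.pow_right n) (Nat.one_lt_two_pow hn)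
  have hodd : Odd ((2 * k + 1) * l') := by
    refine (odd_two_mul_add_one k).mul ?_
    by_contra h
    obtain ⟨r, rfl⟩ := Nat.not_odd_iff_even.mp h
    have h2 : (l * (r + r)) % 2 ^ n % 2 = 1 := by rw [hl']
    rw [Nat.mod_mod_of_dvd _ (dvd_pow_self 2 hn), ← two_mul, mul_left_comm,
      Nat.mul_mod_right] at h2
    exact zero_ne_one h2
  obtain ⟨i, hi⟩ := hodd
  refine ⟨i, ?_⟩
  rw [← hi, pow_mul, hm, ← pow_mul, ← pow_mod_orderOf, ← hη.eq_orderOf, hl', pow_one]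

/-- A number field contains only finitely many roots of unity of `2`-power order. -/
lemma exists_maximal_two_pow_primitiveRoot (K : Type*) [Field K] [NumberField K] :
    ∃ (n : ℕ) (η : K), IsPrimitiveRoot η (2 ^ n) ∧
      ¬ ∃ ξ : K, IsPrimitiveRoot ξ (2 ^ (n + 1)) := by
  classical
  have hex : ∃ n, ¬ ∃ ξ : K, IsPrimitiveRoot ξ (2 ^ (n + 1)) := by
    refine ⟨Module.finrank ℚ K, fun ⟨ξ, hξ⟩ ↦ ?_⟩
    have h1 := hξ.totient_le_degree_minpoly
    have hint : IsIntegral ℤ ξ := hξ.isIntegral (by positivity)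
    have h2 := minpoly.natDegree_le (A := ℚ) ξ
    rw [minpoly.isIntegrallyClosed_eq_field_fractions' ℚ hint,
      (minpoly.monic hint).natDegree_map] at h2
    rw [Nat.totient_prime_pow_succ Nat.prime_two] at h1
    have h3 := Nat.lt_two_pow_self (n := Module.finrank ℚ K)
    omega
  have hspec := Nat.find_spec hex
  rcases h : Nat.find hex with _ | m
  · exact ⟨0, 1, by simp, by rwa [h] at hspec⟩
  · have hm : ∃ ξ : K, IsPrimitiveRoot ξ (2 ^ (m + 1)) :=
      not_not.mp (Nat.find_min hex (by omega))
    obtain ⟨ξ, hξ⟩ := hm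
    exact ⟨m + 1, ξ, hξ, by rwa [h] at hspec⟩

end RootsOfUnity

lemma Subgroup.odd_index_of_odd_pow_mem {G : Type*} [CommGroup G] [Group.FG G] (H : Subgroup G)
    (h : ∀ g : G, ∃ m, Odd m ∧ g ^ m ∈ H) : Odd H.index := by
  have hpow : ∀ q : G ⧸ H, ∃ m, Odd m ∧ q ^ m = 1 := by
    intro q
    obtain ⟨g, rfl⟩ := QuotientGroup.mk_surjective q
    obtain ⟨m, hm, hg⟩ := h g
    exact ⟨m, hm, by rwa [← QuotientGroup.mk_pow, QuotientGroup.eq_one_iff]⟩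
  have hfin : Finite (G ⧸ H) := by
    refine CommGroup.finite_of_fg_isMulTorsion _ ?_
    intro q
    obtain ⟨m, hm, hq⟩ := hpow q
    exact isOfFinOrder_iff_pow_eq_one.mpr ⟨m, hm.pos, hq⟩
  by_contra hodd
  rw [Subgroup.index, Nat.not_odd_iff_even, even_iff_two_dvd] at hodd
  obtain ⟨q, hq⟩ := exists_prime_orderOf_dvd_card' 2 hodd
  obtain ⟨m, hm, hqm⟩ := hpow q
  have h2 := orderOf_dvd_of_pow_eq_one hqm
  rw [hq] at h2
  exact (Nat.not_even_iff_odd.mpr hm) (even_iff_two_dvd.mpr h2)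

section Extension

variable {F K : Type*} [Field F] [Field K] [Algebra F K]

lemma isIntegral_apply {σ : K ≃ₐ[F] K} {z : K} (hz : IsIntegral ℤ z) : IsIntegral ℤ (σ z) :=
  hz.map (σ.toRingEquiv.toRingHom.toIntAlgHom)

/-- Elements of the extension of `M` to `B` are carried into `B` by elements of `F` carrying `M`
into `O_F`. -/
lemma mul_algebraMap_mem_of_mem_span {B : Subalgebra ℤ K}
    (hBOF : ∀ f : F, f ∈ integralClosure ℤ F → algebraMap F K f ∈ B) {M : Set F} {t : F}
    (ht : ∀ α ∈ M, α * t ∈ integralClosure ℤ F) {y : K}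
    (hy : y ∈ Submodule.span B (algebraMap F K '' M)) : y * algebraMap F K t ∈ B := by
  induction hy using Submodule.span_induction with
  | mem y hy =>
    obtain ⟨α, hα, rfl⟩ := hy
    rw [← map_mul]
    exact hBOF _ (ht α hα)
  | zero => simp
  | add y z _ _ hy hz => rw [add_mul]; exact B.add_mem hy hz
  | smul b y _ hy =>
    rw [Subalgebra.smul_def, smul_eq_mul, mul_assoc]
    exact B.mul_mem b.2 hy

lemma span_le_span_of_le {B C : Subalgebra ℤ K} (h : B ≤ C) {S : Set K} {y : K}
    (hy : y ∈ Submodule.span B S) : y ∈ Submodule.span C S := by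
  induction hy using Submodule.span_induction with
  | mem y hy => exact Submodule.subset_span hy
  | zero => exact Submodule.zero_mem _
  | add y z _ _ hy hz => exact Submodule.add_mem _ hy hz
  | smul b y _ hy => exact Submodule.smul_mem _ (⟨b, h b.2⟩ : C) hy

/-- An invertible fractional ideal of `O_F` whose extension to `O_K` is generated by an element
of `F` is generated by that element. -/
lemma eq_span_singleton_of_algebraMap_generates
    (a : (Submodule (integralClosure ℤ F) F)ˣ) {f : F} (hf0 : f ≠ 0)
    (hf : algebraMap F K f ∈ Submodule.span (integralClosure ℤ K)
      (algebraMap F K '' ((a : Submodule (integralClosure ℤ F) F) : Set F)))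
    (h : ∀ α ∈ (a : Submodule (integralClosure ℤ F) F),
      IsIntegral ℤ (algebraMap F K α / algebraMap F K f)) :
    (a : Submodule (integralClosure ℤ F) F) = Submodule.span (integralClosure ℤ F) {f} := by
  have hinj := (algebraMap F K).injective
  refine le_antisymm (fun α hα ↦ ?_) ?_
  · have hint := h α hα
    rw [← map_div₀, isIntegral_algebraMap_iff hinj] at hint
    refine Submodule.mem_span_singleton.mpr ⟨⟨α / f, hint⟩, ?_⟩
    rw [Subalgebra.smul_def, smul_eq_mul]
    exact div_mul_cancel₀ α hf0
  · rw [Submodule.span_le, Set.singleton_subset_iff]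
    have hone : (1 : F) ∈ (↑a⁻¹ * ↑a : Submodule (integralClosure ℤ F) F) := by
      rw [Units.inv_mul]
      exact Submodule.one_le.mp le_rfl
    have key : ∀ c ∈ (↑a⁻¹ * ↑a : Submodule (integralClosure ℤ F) F),
        f * c ∈ (a : Submodule (integralClosure ℤ F) F) := by
      intro c hc
      induction hc using Submodule.mul_induction_on' with
      | mem_mul_mem b hb α hα =>
        have hfb : f * b ∈ integralClosure ℤ F := by
          have hmem := mul_algebraMap_mem_of_mem_span (B := integralClosure ℤ K)
            (fun g hg ↦ (isIntegral_algebraMap_iff hinj).mpr hg) (t := b) (fun α hα ↦ ?_) hf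
          · rw [← map_mul] at hmem
            exact (isIntegral_algebraMap_iff hinj).mp hmem
          · have hab : α * b ∈ (↑a * ↑a⁻¹ : Submodule (integralClosure ℤ F) F) :=
              Submodule.mul_mem_mul hα hb
            rw [Units.mul_inv, Submodule.mem_one] at hab
            obtain ⟨y, hy⟩ := hab
            rw [← hy]
            exact y.2
        rw [← mul_assoc]
        exact Submodule.smul_mem _ (⟨f * b, hfb⟩ : integralClosure ℤ F) hα
      | add c _ d _ hc hd => rw [mul_add]; exact Submodule.add_mem _ hc hd
    simpa using key 1 hone

end Extension

section Quadratic

variable {F K : Type*} [Field F] [NumberField F] [Field K] [NumberField K] [Algebra F K]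

lemma eq_refl_or_eq_of_finrank_eq_two (hquad : Module.finrank F K = 2) {σ : K ≃ₐ[F] K}
    (hσ : σ ≠ AlgEquiv.refl) (τ : K ≃ₐ[F] K) : τ = AlgEquiv.refl ∨ τ = σ := by
  have : Algebra.IsQuadraticExtension F K := ⟨hquad⟩
  have : IsGalois F K := ⟨⟩
  have hc := IsGalois.card_aut_eq_finrank F K
  rw [hquad] at hc
  by_contra! h
  have h3 : ({AlgEquiv.refl, σ, τ} : Set (K ≃ₐ[F] K)).ncard = 3 :=
    Set.ncard_eq_three.mpr ⟨_, _, _, hσ.symm, h.1.symm, h.2.symm, rfl⟩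
  have hle := Set.ncard_le_card ({AlgEquiv.refl, σ, τ} : Set (K ≃ₐ[F] K))
  omega

lemma exists_algebraMap_eq_of_apply_eq (hquad : Module.finrank F K = 2) {σ : K ≃ₐ[F] K}
    (hσ : σ ≠ AlgEquiv.refl) {z : K} (hz : σ z = z) : ∃ f, algebraMap F K f = z := by
  have : Algebra.IsQuadraticExtension F K := ⟨hquad⟩
  have : IsGalois F K := ⟨⟩
  refine IntermediateField.mem_bot.mp ((IsGalois.mem_bot_iff_fixed z).mpr fun τ ↦ ?_)
  rcases eq_refl_or_eq_of_finrank_eq_two hquad hσ τ with rfl | rfl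
  · rfl
  · exact hz

lemma apply_apply_of_finrank_eq_two (hquad : Module.finrank F K = 2) {σ : K ≃ₐ[F] K}
    (hσ : σ ≠ AlgEquiv.refl) (z : K) : σ (σ z) = z := by
  rcases eq_refl_or_eq_of_finrank_eq_two hquad hσ (σ.trans σ) with h | h
  · exact DFunLike.congr_fun h z
  · refine (hσ (AlgEquiv.ext fun w ↦ ?_)).elim
    exact σ.injective (DFunLike.congr_fun h w)

/-- In a CM extension the nontrivial automorphism is complex conjugation in every embedding. -/
lemma conj_apply_eq_apply (hF : TotReal F) (hquad : Module.finrank F K = 2)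
    (hCM : IsEmpty (K →+* ℝ)) {σ : K ≃ₐ[F] K} (hσ : σ ≠ AlgEquiv.refl) (φ : K →+* ℂ) (z : K) :
    (starRingEnd ℂ) (φ z) = φ (σ z) := by
  have : Algebra.IsQuadraticExtension F K := ⟨hquad⟩
  have : IsGalois F K := ⟨⟩
  obtain ⟨τ, hτ⟩ := NumberField.ComplexEmbedding.exists_comp_symm_eq_of_comp_eq (k := F) φ
    (NumberField.ComplexEmbedding.conjugate φ) (by
      ext f
      exact (DFunLike.congr_fun (hF (φ.comp (algebraMap F K))) f).symm)
  have hz : ∀ w, φ (τ.symm w) = (starRingEnd ℂ) (φ w) := fun w ↦ DFunLike.congr_fun hτ w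
  rcases eq_refl_or_eq_of_finrank_eq_two hquad hσ τ.symm with h | h
  · have hreal : NumberField.ComplexEmbedding.IsReal φ := by
      ext w
      have := hz w
      rw [h] at this
      exact this.symm
    exact hCM.elim hreal.embedding
  · rw [← hz, h]

lemma isOfFinOrder_of_mul_apply_eq_one (hF : TotReal F) (hquad : Module.finrank F K = 2)
    (hCM : IsEmpty (K →+* ℝ)) {σ : K ≃ₐ[F] K} (hσ : σ ≠ AlgEquiv.refl) {u : K}
    (hu : IsIntegral ℤ u) (h : u * σ u = 1) : IsOfFinOrder u := by
  obtain ⟨n, hn, hu⟩ := NumberField.Embeddings.pow_eq_one_of_norm_eq_one K ℂ hu fun φ ↦ by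
    have h1 : φ u * (starRingEnd ℂ) (φ u) = 1 := by
      rw [conj_apply_eq_apply hF hquad hCM hσ, ← map_mul, h, map_one]
    rw [Complex.mul_conj, Complex.normSq_eq_norm_sq] at h1
    exact (pow_eq_one_iff_of_nonneg (norm_nonneg _) two_ne_zero).mp (by exact_mod_cast h1)
  exact isOfFinOrder_iff_pow_eq_one.mpr ⟨n, hn, hu⟩

lemma mul_apply_eq_one_of_isOfFinOrder (hF : TotReal F) (hquad : Module.finrank F K = 2)
    (hCM : IsEmpty (K →+* ℝ)) {σ : K ≃ₐ[F] K} (hσ : σ ≠ AlgEquiv.refl) {u : K}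
    (hu : IsOfFinOrder u) : u * σ u = 1 := by
  obtain ⟨φ⟩ : Nonempty (K →+* ℂ) := inferInstance
  refine φ.injective ?_
  have h1 : ‖φ u‖ = 1 := (φ.toMonoidHom.isOfFinOrder hu).norm_eq_one
  rw [map_mul, ← conj_apply_eq_apply hF hquad hCM hσ, Complex.mul_conj, Complex.normSq_eq_norm_sq,
    h1]
  simp

lemma apply_mem_of_finrank_eq_two (hquad : Module.finrank F K = 2) {σ : K ≃ₐ[F] K}
    (hσ : σ ≠ AlgEquiv.refl) {B : Subalgebra ℤ K} (hBO : B ≤ integralClosure ℤ K)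
    (hBOF : ∀ f : F, f ∈ integralClosure ℤ F → algebraMap F K f ∈ B) {b : K} (hb : b ∈ B) :
    σ b ∈ B := by
  obtain ⟨f, hf⟩ := exists_algebraMap_eq_of_apply_eq hquad hσ (z := b + σ b) (by
    rw [map_add, apply_apply_of_finrank_eq_two hquad hσ, add_comm])
  have hint : IsIntegral ℤ (algebraMap F K f) := hf ▸ (hBO hb).add (isIntegral_apply (hBO hb))
  have hmem := hBOF f ((isIntegral_algebraMap_iff (algebraMap F K).injective).mp hint)
  rw [hf] at hmem
  simpa using B.sub_mem hmem hb

/-- An element generating the extension to `O_K` of a nonprincipal ideal of `O_F` never differs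
from its conjugate by the factor `v / σ v` for a unit `v`. -/
lemma mul_apply_ne_apply_mul_of_not_principal (hquad : Module.finrank F K = 2) {σ : K ≃ₐ[F] K}
    (hσ : σ ≠ AlgEquiv.refl) (a : (Submodule (integralClosure ℤ F) F)ˣ)
    (hnp : ¬ ∃ x : F, x ≠ 0 ∧ (a : Submodule (integralClosure ℤ F) F)
      = Submodule.span (integralClosure ℤ F) {x})
    {x : K} (hx0 : x ≠ 0)
    (hx : x ∈ Submodule.span (integralClosure ℤ K)
      (algebraMap F K '' ((a : Submodule (integralClosure ℤ F) F) : Set F)))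
    (hgen : ∀ α ∈ (a : Submodule (integralClosure ℤ F) F), IsIntegral ℤ (algebraMap F K α / x))
    {v : K} (hv0 : v ≠ 0) (hv : IsIntegral ℤ v) (hv' : IsIntegral ℤ v⁻¹) :
    x * σ v ≠ σ x * v := by
  intro h
  have hσv : σ v ≠ 0 := (map_ne_zero σ).mpr hv0
  obtain ⟨f, hf⟩ := exists_algebraMap_eq_of_apply_eq hquad hσ (z := x / v) (by
    rw [map_div₀, div_eq_div_iff hσv hv0, ← h])
  refine hnp ⟨f, ?_, eq_span_singleton_of_algebraMap_generates (K := K) a ?_ ?_ ?_⟩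
  · rintro rfl
    exact div_ne_zero hx0 hv0 (hf ▸ map_zero _)
  · rintro rfl
    exact div_ne_zero hx0 hv0 (hf ▸ map_zero _)
  · have := Submodule.smul_mem _ (⟨v⁻¹, hv'⟩ : integralClosure ℤ K) hx
    rwa [Subalgebra.smul_def, smul_eq_mul, mul_comm, ← div_eq_mul_inv, ← hf] at this
  · intro α hα
    rw [hf, div_div_eq_mul_div, mul_div_right_comm]
    exact (hgen α hα).mul hv

lemma apply_mem_span_image (hquad : Module.finrank F K = 2) {σ : K ≃ₐ[F] K}
    (hσ : σ ≠ AlgEquiv.refl) {B : Subalgebra ℤ K} (hBO : B ≤ integralClosure ℤ K)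
    (hBOF : ∀ f : F, f ∈ integralClosure ℤ F → algebraMap F K f ∈ B) {M : Set F} {y : K}
    (hy : y ∈ Submodule.span B (algebraMap F K '' M)) :
    σ y ∈ Submodule.span B (algebraMap F K '' M) := by
  induction hy using Submodule.span_induction with
  | mem y hy =>
    obtain ⟨α, hα, rfl⟩ := hy
    rw [σ.commutes]
    exact Submodule.subset_span ⟨α, hα, rfl⟩
  | zero => simp
  | add y z _ _ hy hz => rw [map_add]; exact Submodule.add_mem _ hy hz
  | smul b y _ hy =>
    rw [Subalgebra.smul_def, smul_eq_mul, map_mul]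
    exact Submodule.smul_mem _
      (⟨σ b, apply_mem_of_finrank_eq_two hquad hσ hBO hBOF b.2⟩ : B) hy

/-- If a nonprincipal ideal of `O_F` becomes principal in `B`, then `B` contains the roots of unity
of `2`-power order, and the ideal has a generator differing from its conjugate by a generator of
these. -/
lemma exists_generator_eq_mul_apply (hF : TotReal F) (hquad : Module.finrank F K = 2)
    (hCM : IsEmpty (K →+* ℝ)) {σ : K ≃ₐ[F] K} (hσ : σ ≠ AlgEquiv.refl)
    (a : (Submodule (integralClosure ℤ F) F)ˣ)
    (hnp : ¬ ∃ x : F, x ≠ 0 ∧ (a : Submodule (integralClosure ℤ F) F)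
      = Submodule.span (integralClosure ℤ F) {x})
    {B : Subalgebra ℤ K} (hBO : B ≤ integralClosure ℤ K)
    (hBOF : ∀ f : F, f ∈ integralClosure ℤ F → algebraMap F K f ∈ B)
    (hcap : ∃ x : K, x ≠ 0 ∧
      Submodule.span B (algebraMap F K '' ((a : Submodule (integralClosure ℤ F) F) : Set F))
        = Submodule.span B {x})
    {n : ℕ} {η : K} (hη : IsPrimitiveRoot η (2 ^ n))
    (hmax : ¬ ∃ ξ : K, IsPrimitiveRoot ξ (2 ^ (n + 1))) :
    η ∈ B ∧ ∃ y : K, y ≠ 0 ∧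
      y ∈ Submodule.span B
        (algebraMap F K '' ((a : Submodule (integralClosure ℤ F) F) : Set F)) ∧
      (∀ α ∈ (a : Submodule (integralClosure ℤ F) F), IsIntegral ℤ (algebraMap F K α / y)) ∧
      y = η * σ y := by
  obtain ⟨x, hx0, hspan⟩ := hcap
  have hσx0 : σ x ≠ 0 := (map_ne_zero σ).mpr hx0
  have hx : x ∈ Submodule.span B
      (algebraMap F K '' ((a : Submodule (integralClosure ℤ F) F) : Set F)) :=
    hspan ▸ Submodule.mem_span_singleton_self x
  have hgen : ∀ α ∈ (a : Submodule (integralClosure ℤ F) F),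
      IsIntegral ℤ (algebraMap F K α / x) := by
    intro α hα
    have hmem : algebraMap F K α ∈ Submodule.span B {x} :=
      hspan ▸ Submodule.subset_span ⟨α, hα, rfl⟩
    obtain ⟨b, hb⟩ := Submodule.mem_span_singleton.mp hmem
    rw [← hb, Subalgebra.smul_def, smul_eq_mul, mul_div_cancel_right₀ _ hx0]
    exact hBO b.2
  have hσx := apply_mem_span_image hquad hσ hBO hBOF hx
  rw [hspan] at hσx
  obtain ⟨b, hb⟩ := Submodule.mem_span_singleton.mp hσx
  rw [Subalgebra.smul_def, smul_eq_mul] at hb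
  obtain ⟨u, hu⟩ : ∃ u, u = x / σ x := ⟨_, rfl⟩
  have hu0 : u ≠ 0 := hu ▸ div_ne_zero hx0 hσx0
  have hσu : σ u = u⁻¹ := by
    rw [hu, map_div₀, apply_apply_of_finrank_eq_two hquad hσ, inv_div]
  have huB : u ∈ B := by
    have hbu : (b : K) = u⁻¹ := by
      rw [hu, inv_div, ← hb, mul_div_cancel_right₀ _ hx0]
    have := apply_mem_of_finrank_eq_two hquad hσ hBO hBOF b.2
    rwa [hbu, map_inv₀, hσu, inv_inv] at this
  have hufin : IsOfFinOrder u := isOfFinOrder_of_mul_apply_eq_one hF hquad hCM hσ (hBO huB) (by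
    rw [hσu, mul_inv_cancel₀ hu0])
  have hσxu : x = u * σ x := by rw [hu, div_mul_cancel₀ _ hσx0]
  have hsq : ¬ IsSquare u := by
    rintro ⟨w, hw⟩
    have hwfin : IsOfFinOrder w := by
      rw [hw, ← pow_two] at hufin
      exact hufin.of_pow two_ne_zero
    have hw0 : w ≠ 0 := by rintro rfl; simp [hw] at hu0
    have hwσ := mul_apply_eq_one_of_isOfFinOrder hF hquad hCM hσ hwfin
    have hwint : ∀ {r : K}, IsOfFinOrder r → IsIntegral ℤ r := fun {r} hr ↦
      (IsPrimitiveRoot.orderOf r).isIntegral hr.orderOf_pos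
    refine mul_apply_ne_apply_mul_of_not_principal hquad hσ a hnp hx0
      (span_le_span_of_le hBO hx) hgen hw0 (hwint hwfin)
      (eq_inv_of_mul_eq_one_right hwσ ▸ isIntegral_apply (hwint hwfin)) ?_
    calc x * σ w = w * w * σ x * σ w := by rw [← hw, ← hσxu]
      _ = σ x * w * (w * σ w) := by ring
      _ = σ x * w := by rw [hwσ, mul_one]
  obtain ⟨i, hi⟩ := exists_odd_pow_eq_of_not_isSquare hη hmax hufin hsq
  have huint : IsIntegral ℤ u⁻¹ := hσu ▸ isIntegral_apply (hBO huB)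
  refine ⟨hi ▸ B.pow_mem huB _, u ^ i * x, mul_ne_zero (pow_ne_zero _ hu0) hx0,
    Submodule.smul_mem _ (⟨u ^ i, B.pow_mem huB i⟩ : B) hx, fun α hα ↦ ?_, ?_⟩
  · have : algebraMap F K α / (u ^ i * x) = (u⁻¹) ^ i * (algebraMap F K α / x) := by
      rw [inv_pow]
      field_simp
    rw [this]
    exact (huint.pow i).mul (hgen α hα)
  · rw [map_mul, map_pow, hσu, ← hi, inv_pow]
    nth_rewrite 1 [hσxu]
    field_simp
    ring

lemma one_sub_mul_mem (hquad : Module.finrank F K = 2) {σ : K ≃ₐ[F] K} (hσ : σ ≠ AlgEquiv.refl)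
    {B : Subalgebra ℤ K} (hBOF : ∀ f : F, f ∈ integralClosure ℤ F → algebraMap F K f ∈ B)
    {M : Set F} {y : K} (hy0 : y ≠ 0) (hy : y ∈ Submodule.span B (algebraMap F K '' M))
    (hgen : ∀ α ∈ M, IsIntegral ℤ (algebraMap F K α / y))
    {η : K} (hη : IsIntegral ℤ η) (hyη : y = η * σ y) {z : K} (hz : IsIntegral ℤ z) :
    (1 - η) * z ∈ B := by
  have hσσ := apply_apply_of_finrank_eq_two hquad hσ
  have hσy0 : σ y ≠ 0 := (map_ne_zero σ).mpr hy0
  have hηση : η * σ η = 1 := by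
    have h := congrArg σ hyη
    rw [map_mul, hσσ] at h
    refine mul_right_cancel₀ hσy0 ?_
    rw [one_mul, mul_right_comm, ← hyη, mul_comm, ← h]
  have htrace : z + σ z ∈ B := by
    obtain ⟨f, hf⟩ := exists_algebraMap_eq_of_apply_eq hquad hσ (z := z + σ z) (by
      rw [map_add, hσσ, add_comm])
    have hint : IsIntegral ℤ (algebraMap F K f) := hf ▸ hz.add (isIntegral_apply hz)
    exact hf ▸ hBOF f ((isIntegral_algebraMap_iff (algebraMap F K).injective).mp hint)
  have htwist : η * z + σ z ∈ B := by
    have hw : η * σ (η * z + σ z) = η * z + σ z := by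
      rw [map_add, map_mul, hσσ, mul_add, ← mul_assoc, hηση, one_mul, add_comm]
    obtain ⟨t, ht⟩ := exists_algebraMap_eq_of_apply_eq hquad hσ (z := (η * z + σ z) / y) (by
      have hη0 : η ≠ 0 := left_ne_zero_of_mul_eq_one hηση
      rw [map_div₀, div_eq_div_iff hσy0 hy0]
      refine mul_left_cancel₀ hη0 ?_
      rw [← mul_assoc, hw, mul_left_comm, ← hyη])
    have hmem := mul_algebraMap_mem_of_mem_span hBOF (t := t) (fun α hα ↦ ?_) hy
    · rwa [ht, mul_div_cancel₀ _ hy0] at hmem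
    · refine (isIntegral_algebraMap_iff (algebraMap F K).injective).mp ?_
      rw [map_mul, ht, mul_div_left_comm, mul_comm]
      exact (hgen α hα).mul ((hη.mul hz).add (isIntegral_apply hz))
  have := B.sub_mem htrace htwist
  rwa [add_sub_add_right_eq_sub, ← one_sub_mul] at this

lemma exists_odd_pow_mem (hF : TotReal F) (hquad : Module.finrank F K = 2)
    (hCM : IsEmpty (K →+* ℝ)) {σ : K ≃ₐ[F] K} (hσ : σ ≠ AlgEquiv.refl)
    (a : (Submodule (integralClosure ℤ F) F)ˣ)
    (hnp : ¬ ∃ x : F, x ≠ 0 ∧ (a : Submodule (integralClosure ℤ F) F)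
      = Submodule.span (integralClosure ℤ F) {x})
    {B : Subalgebra ℤ K} (hBOF : ∀ f : F, f ∈ integralClosure ℤ F → algebraMap F K f ∈ B)
    {y : K} (hy0 : y ≠ 0)
    (hy : y ∈ Submodule.span (integralClosure ℤ K)
      (algebraMap F K '' ((a : Submodule (integralClosure ℤ F) F) : Set F)))
    (hgen : ∀ α ∈ (a : Submodule (integralClosure ℤ F) F), IsIntegral ℤ (algebraMap F K α / y))
    {n : ℕ} {η : K} (hη : IsPrimitiveRoot η (2 ^ n))
    (hmax : ¬ ∃ ξ : K, IsPrimitiveRoot ξ (2 ^ (n + 1))) (hηB : η ∈ B) (hyη : y = η * σ y)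
    {v : K} (hv0 : v ≠ 0) (hv : IsIntegral ℤ v) (hv' : IsIntegral ℤ v⁻¹) :
    ∃ m, Odd m ∧ v ^ m ∈ B := by
  have hσσ := apply_apply_of_finrank_eq_two hquad hσ
  have hσv0 : σ v ≠ 0 := (map_ne_zero σ).mpr hv0
  have hwint : IsIntegral ℤ (v / σ v) := by
    rw [div_eq_mul_inv, ← map_inv₀]
    exact hv.mul (isIntegral_apply hv')
  have hwfin : IsOfFinOrder (v / σ v) :=
    isOfFinOrder_of_mul_apply_eq_one hF hquad hCM hσ hwint (by
      rw [map_div₀, hσσ]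
      field_simp)
  have hwsq : IsSquare (v / σ v) := by
    by_contra hsq
    obtain ⟨i, hi⟩ := exists_odd_pow_eq_of_not_isSquare hη hmax hwfin hsq
    refine mul_apply_ne_apply_mul_of_not_principal hquad hσ a hnp hy0 hy hgen
      (pow_ne_zero (2 * i + 1) hv0) (hv.pow _) (inv_pow v _ ▸ hv'.pow _) ?_
    rw [div_pow, div_eq_iff (pow_ne_zero _ hσv0)] at hi
    nth_rewrite 1 [hyη]
    rw [map_pow, hi]
    ring
  obtain ⟨ζ, hζ⟩ := hwsq
  have hζfin : IsOfFinOrder ζ := by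
    rw [hζ, ← pow_two] at hwfin
    exact hwfin.of_pow two_ne_zero
  have hζσ := mul_apply_eq_one_of_isOfFinOrder hF hquad hCM hσ hζfin
  have hζ0 : ζ ≠ 0 := left_ne_zero_of_mul_eq_one hζσ
  have hσζ : σ ζ = ζ⁻¹ := eq_inv_of_mul_eq_one_right hζσ
  have hζint : IsIntegral ℤ ζ :=
    (IsPrimitiveRoot.orderOf ζ).isIntegral hζfin.orderOf_pos
  obtain ⟨f, hf⟩ := exists_algebraMap_eq_of_apply_eq hquad hσ (z := v * σ ζ) (by
    rw [div_eq_iff hσv0] at hζ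
    rw [map_mul, hσσ, hσζ]
    nth_rewrite 2 [hζ]
    field_simp)
  have hfint : IsIntegral ℤ (algebraMap F K f) := hf ▸ hv.mul (isIntegral_apply hζint)
  have hfB := hBOF f ((isIntegral_algebraMap_iff (algebraMap F K).injective).mp hfint)
  obtain ⟨m, l, hm, hml⟩ := exists_odd_pow_eq_pow hη hmax hζfin
  refine ⟨m, hm, ?_⟩
  have hvf : v = algebraMap F K f * ζ := by
    rw [hf, mul_assoc, mul_comm (σ ζ), hζσ, mul_one]
  rw [hvf, mul_pow, hml]
  exact B.mul_mem (B.pow_mem hfB _) (B.pow_mem hηB _)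

end Quadratic

lemma Subalgebra.mem_range_unitsMap_inclusion {R A : Type*} [CommRing R] [Field A] [Algebra R A]
    {B C : Subalgebra R A} (h : B ≤ C) {v : Cˣ} (hv : ((v : C) : A) ∈ B)
    (hv' : (((v⁻¹ : Cˣ) : C) : A) ∈ B) :
    v ∈ (Units.map (Subalgebra.inclusion h).toRingHom.toMonoidHom).range := by
  refine ⟨⟨⟨_, hv⟩, ⟨_, hv'⟩, Subtype.ext ?_, Subtype.ext ?_⟩, Units.ext (Subtype.ext rfl)⟩
  · exact congrArg (Subtype.val : C → A) v.mul_inv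
  · exact congrArg (Subtype.val : C → A) v.inv_mul

theorem unit_index_odd_of_capitulating_order
    {F : Type*} [Field F] [NumberField F] (hF : TotReal F)
    {K : Type*} [Field K] [NumberField K] [Algebra F K]
    (hquad : Module.finrank F K = 2) (hCM : IsEmpty (K →+* ℝ))
    (σ : K ≃ₐ[F] K) (hσ : σ ≠ AlgEquiv.refl)
    -- the unique nontrivial class `[a] ∈ ker (i_{K/F})`
    (a : (Submodule ↥(integralClosure ℤ F) F)ˣ)
    (hnp : ¬ ∃ x : F, x ≠ 0 ∧ (a : Submodule ↥(integralClosure ℤ F) F)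
      = Submodule.span ↥(integralClosure ℤ F) {x})
    (lam : K) (hlam : lam ≠ 0)
    (hext : Submodule.span ↥(integralClosure ℤ K)
        (algebraMap F K '' ((a : Submodule ↥(integralClosure ℤ F) F) : Set F))
      = Submodule.span ↥(integralClosure ℤ K) {lam})
    -- an `O_F`-order `B ⊆ O_K` ...
    (B : Subalgebra ℤ K) (hB : IsZOrder B) (hBO : B ≤ integralClosure ℤ K)
    (hBOF : ∀ f : F, f ∈ integralClosure ℤ F → algebraMap F K f ∈ B)
    -- ... with `[a] ∈ ker (i_{B/O_F})`
    (hcap : ∃ x : K, x ≠ 0 ∧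
      Submodule.span ↥B
          (algebraMap F K '' ((a : Submodule ↥(integralClosure ℤ F) F) : Set F))
        = Submodule.span ↥B {x}) :
    -- the unit index `[O_K^× : B^×]` is odd
    (Odd (Units.map ((Subalgebra.inclusion hBO).toRingHom.toMonoidHom)).range.index) ∧
    -- if `K ≠ F(√−1)` then `2·O_K ⊆ B`
    ((¬ ∃ t : K, t ^ 2 = -1) → ∀ z : K, z ∈ integralClosure ℤ K → 2 * z ∈ B) ∧
    -- if `K = F(√−1)` then `(2 − η − η̄)·O_K ⊆ B`
    ((∃ t : K, t ^ 2 = -1) →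
      ∀ (n : ℕ) (η : K), IsPrimitiveRoot η (2 ^ n) →
        (¬ ∃ ξ : K, IsPrimitiveRoot ξ (2 ^ (n + 1))) →
        ∀ z : K, z ∈ integralClosure ℤ K → (2 - η - σ η) * z ∈ B) := by
  have hgenerator := fun {n : ℕ} {η : K} ↦
    exists_generator_eq_mul_apply (n := n) (η := η) hF hquad hCM hσ a hnp hBO hBOF hcap
  have hmem : ∀ (n : ℕ) (η : K), IsPrimitiveRoot η (2 ^ n) →
      (¬ ∃ ξ : K, IsPrimitiveRoot ξ (2 ^ (n + 1))) →
      ∀ z : K, z ∈ integralClosure ℤ K → (1 - η) * z ∈ B := by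
    intro n η hη hmax z hz
    obtain ⟨-, y, hy0, hy, hgen, hyη⟩ := hgenerator hη hmax
    exact one_sub_mul_mem hquad hσ hBOF hy0 hy hgen (hη.isIntegral (by positivity)) hyη hz
  refine ⟨?_, fun hi z hz ↦ ?_, fun _ n η hη hmax z hz ↦ ?_⟩
  · obtain ⟨n, η, hη, hmax⟩ := exists_maximal_two_pow_primitiveRoot K
    obtain ⟨hηB, y, hy0, hy, hgen, hyη⟩ := hgenerator hη hmax
    have hpow : ∀ v : (integralClosure ℤ K)ˣ, ∃ m, Odd m ∧
        ((v : integralClosure ℤ K) : K) ^ m ∈ B := by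
      intro v
      have hinv : (((v⁻¹ : (integralClosure ℤ K)ˣ) : integralClosure ℤ K) : K)
          = ((v : integralClosure ℤ K) : K)⁻¹ :=
        eq_inv_of_mul_eq_one_right (congrArg Subtype.val v.mul_inv)
      exact exists_odd_pow_mem hF hquad hCM hσ a hnp hBOF hy0 (span_le_span_of_le hBO hy) hgen hη
        hmax hηB hyη (left_ne_zero_of_mul_eq_one (congrArg Subtype.val v.mul_inv))
        (v : integralClosure ℤ K).2 (hinv ▸ (v⁻¹ : (integralClosure ℤ K)ˣ).val.2)
    have hfg : Group.FG (integralClosure ℤ K)ˣ :=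
      Group.fg_iff_monoid_fg.mpr (inferInstanceAs (Monoid.FG (NumberField.RingOfIntegers K)ˣ))
    refine Subgroup.odd_index_of_odd_pow_mem _ fun v ↦ ?_
    obtain ⟨m, hm, hv⟩ := hpow v
    obtain ⟨m', hm', hv'⟩ := hpow v⁻¹
    refine ⟨m * m', hm.mul hm', Subalgebra.mem_range_unitsMap_inclusion hBO ?_ ?_⟩
    · rw [pow_mul]
      exact B.pow_mem hv m'
    · rw [mul_comm, ← inv_pow, pow_mul]
      exact B.pow_mem hv' m
  · have h := hmem 1 (-1) (by simpa using IsPrimitiveRoot.neg_one (R := K) 0 (by norm_num)) ?_ z hz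
    · rwa [sub_neg_eq_add, one_add_one_eq_two] at h
    · rintro ⟨ξ, hξ⟩
      refine hi ⟨ξ, ?_⟩
      have h2 : IsPrimitiveRoot (ξ ^ 2) 2 := hξ.pow (by norm_num) (by norm_num)
      exact h2.eq_neg_one_of_two_right
  · have hσz : (1 - σ η) * z ∈ integralClosure ℤ K :=
      (isIntegral_one.sub (isIntegral_apply (hη.isIntegral (by positivity)))).mul hz
    have hησ := mul_apply_eq_one_of_isOfFinOrder hF hquad hCM hσ
      (isOfFinOrder_iff_pow_eq_one.mpr ⟨2 ^ n, by positivity, hη.pow_eq_one⟩)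
    have h := hmem n η hη hmax _ hσz
    have heq : (1 - η) * ((1 - σ η) * z) = (2 - η - σ η) * z := by
      linear_combination z * hησ
    rwa [heq] at h

end
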